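/- The K-algebra S ⊗_R K is a division ring; together with the fact that S is free of rank e² over R, it is a central division algebra over K of dimension e². -/

import Mathlib

attribute [-instance] RingQuot.instAddCommMonoid

set_option synthInstance.maxHeartbeats 1000000
set_option maxHeartbeats 2000000
noncomputable section
abbrev R : Type := MvPowerSeries (Fin 2) ℂ
abbrev u : R := MvPowerSeries.X 0
abbrev v : R := MvPowerSeries.X 1

/-- The defining relations of `S = R⟨x,y⟩/(x^e−u, y^e−v, yx−ζxy)`. -/
inductive Srel (e : ℕ) (ζ : ℂ) : FreeAlgebra R (Fin 2) → FreeAlgebra R (Fin 2) → Prop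
  | xe : Srel e ζ (FreeAlgebra.ι R (0 : Fin 2) ^ e) (algebraMap R _ u)
  | ye : Srel e ζ (FreeAlgebra.ι R (1 : Fin 2) ^ e) (algebraMap R _ v)
  | comm : Srel e ζ (FreeAlgebra.ι R (1 : Fin 2) * FreeAlgebra.ι R (0 : Fin 2))
      (algebraMap R _ (algebraMap ℂ R ζ) * (FreeAlgebra.ι R (0 : Fin 2) * FreeAlgebra.ι R (1 : Fin 2)))

/-- The `R`-algebra `S`. -/
abbrev Salg (e : ℕ) (ζ : ℂ) : Type := RingQuot (Srel e ζ)

/-- The generator `x ∈ S`. -/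
def xS (e : ℕ) (ζ : ℂ) : Salg e ζ := RingQuot.mkAlgHom R (Srel e ζ) (FreeAlgebra.ι R 0)

/-- The generator `y ∈ S`. -/
def yS (e : ℕ) (ζ : ℂ) : Salg e ζ := RingQuot.mkAlgHom R (Srel e ζ) (FreeAlgebra.ι R 1)


instance : IsDomain R := NoZeroDivisors.to_isDomain _

/-- `K`, the field of fractions of `R`. -/
abbrev K : Type := FractionRing R

open scoped TensorProduct

section LexOrder

open MvPowerSeries

theorem MvPowerSeries.sum_ne_zero_of_lexOrder_injOn {σ A ι : Type*} [LinearOrder σ]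
    [WellFoundedGT σ] [Semiring A] {s : Finset ι} {f : ι → MvPowerSeries σ A}
    (hne : ∃ i ∈ s, f i ≠ 0)
    (hinj : ∀ i ∈ s, ∀ j ∈ s, f i ≠ 0 → f j ≠ 0 → lexOrder (f i) = lexOrder (f j) → i = j) :
    ∑ i ∈ s, f i ≠ 0 := by
  classical
  obtain ⟨k, hk, hk0⟩ := hne
  obtain ⟨i, hi, hmin⟩ := s.exists_min_image (fun i => lexOrder (f i)) ⟨k, hk⟩
  have hi0 : f i ≠ 0 := by
    intro h
    have := hmin k hk
    rw [h, lexOrder_zero, top_le_iff, lexOrder_eq_top_iff_eq_zero] at this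
    exact hk0 this
  obtain ⟨d, hd⟩ := exists_finsupp_eq_lexOrder_of_ne_zero hi0
  intro h0
  have hc : coeff d (∑ j ∈ s, f j) = coeff d (f i) := by
    rw [map_sum]
    refine Finset.sum_eq_single_of_mem i hi fun j hj hji => ?_
    by_cases hj0 : f j = 0
    · simp [hj0]
    · refine coeff_eq_zero_of_lt_lexOrder ?_
      rw [← hd]
      exact lt_of_le_of_ne (hmin j hj) fun h => hji (hinj i hi j hj hi0 hj0 h).symm
  rw [h0, map_zero] at hc
  exact coeff_ne_zero_of_lexOrder hd.symm hc.symm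

theorem MvPowerSeries.X_ne_zero {σ A : Type*} [Semiring A] [Nontrivial A] (s : σ) :
    (X s : MvPowerSeries σ A) ≠ 0 := by
  classical
  exact fun h => by simpa using congrArg (coeff (Finsupp.single s 1)) h

theorem MvPowerSeries.lexOrder_X {σ A : Type*} [LinearOrder σ] [WellFoundedGT σ] [Semiring A]
    [Nontrivial A] (s : σ) :
    lexOrder (X s : MvPowerSeries σ A) = toLex (Finsupp.single s 1) := by
  classical
  obtain ⟨d, hd⟩ := exists_finsupp_eq_lexOrder_of_ne_zero (X_ne_zero (A := A) s)
  have hc := coeff_ne_zero_of_lexOrder hd.symm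
  rw [coeff_X] at hc
  rw [hd, show d = Finsupp.single s 1 by by_contra h; simp [h] at hc]

theorem MvPowerSeries.exists_lexOrder_expand {σ A : Type*} [LinearOrder σ] [WellFoundedGT σ]
    [CommRing A] (p : ℕ) (hp : p ≠ 0) {φ : MvPowerSeries σ A} (hφ : φ ≠ 0) :
    ∃ d : σ →₀ ℕ, (∀ i, p ∣ d i) ∧ lexOrder (expand p hp φ) = toLex d := by
  have hne : expand p hp φ ≠ 0 := by
    intro h
    refine hφ (MvPowerSeries.ext fun m => ?_)
    rw [← coeff_expand_smul p hp, h, map_zero, map_zero]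
  obtain ⟨d, hd⟩ := exists_finsupp_eq_lexOrder_of_ne_zero hne
  refine ⟨d, fun i => ?_, hd⟩
  by_contra h
  exact coeff_ne_zero_of_lexOrder hd.symm (coeff_expand_of_not_dvd p hp φ h)

theorem MvPowerSeries.lexOrder_rescale {σ A : Type*} [LinearOrder σ] [WellFoundedGT σ]
    [CommRing A] {a : σ → A} (ha : ∀ s, IsUnit (a s)) (φ : MvPowerSeries σ A) :
    lexOrder (rescale a φ) = lexOrder φ := by
  have key : ∀ d, coeff d (rescale a φ) = 0 ↔ coeff d φ = 0 := fun d => by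
    rw [coeff_rescale]
    refine IsUnit.mul_right_eq_zero ?_
    exact IsUnit.prod_iff.2 fun s _ => (ha s).pow _
  refine le_antisymm ?_ ?_
  · refine le_lexOrder_iff.2 fun d hd => (key d).1 (coeff_eq_zero_of_lt_lexOrder hd)
  · refine le_lexOrder_iff.2 fun d hd => (key d).2 (coeff_eq_zero_of_lt_lexOrder hd)

theorem MvPowerSeries.rescale_expand {σ A : Type*} [CommRing A] (p : ℕ) (hp : p ≠ 0)
    {a : σ → A} (ha : ∀ s, a s ^ p = 1) (φ : MvPowerSeries σ A) :
    rescale a (expand p hp φ) = expand p hp φ := by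
  ext d
  rw [coeff_rescale]
  by_cases h : ∀ i, p ∣ d i
  · rw [Finsupp.prod, Finset.prod_eq_one, one_mul]
    intro s _
    obtain ⟨k, hk⟩ := h s
    rw [hk, pow_mul, ha, one_pow]
  · push Not at h
    obtain ⟨i, hi⟩ := h
    rw [coeff_expand_of_not_dvd p hp φ hi, mul_zero]

theorem MvPowerSeries.rescale_X {σ A : Type*} [CommRing A] (a : σ → A) (s : σ) :
    rescale a (X s) = C (a s) * X s := by
  classical
  ext d
  rw [coeff_rescale, coeff_C_mul, coeff_X]
  split_ifs with h
  · subst h; simp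
  · simp

end LexOrder

section Representation

/-- The ring `ℂ[[x,y]]`, regarded as an `R`-algebra through `u ↦ x ^ e`, `v ↦ y ^ e`. -/
def RootSeries (_e : ℕ) : Type := MvPowerSeries (Fin 2) ℂ

variable (e : ℕ) [NeZero e] (ζ : ℂ)

instance : CommRing (RootSeries e) := inferInstanceAs (CommRing (MvPowerSeries (Fin 2) ℂ))

/-- The identity map, from power series to `RootSeries`. -/
def RootSeries.of : MvPowerSeries (Fin 2) ℂ ≃+* RootSeries e :=
  RingEquiv.refl (MvPowerSeries (Fin 2) ℂ)

instance : Algebra R (RootSeries e) :=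
  ((RootSeries.of e).toRingHom.comp
    (MvPowerSeries.expand (σ := Fin 2) (R := ℂ) e (NeZero.ne e)).toRingHom).toAlgebra

theorem RootSeries.smul_of (r : R) (g : MvPowerSeries (Fin 2) ℂ) :
    r • RootSeries.of e g = RootSeries.of e (MvPowerSeries.expand e (NeZero.ne e) r * g) := rfl

/-- Multiplication by `x` on `ℂ[[x,y]]`. -/
def xOp : Module.End R (RootSeries e) :=
  LinearMap.mulLeft R (RootSeries.of e (MvPowerSeries.X 0))

variable {e ζ}

/-- The operator `f(x,y) ↦ y f(ζx,y)` on `ℂ[[x,y]]`. -/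
def yOp (hζ : ζ ^ e = 1) : Module.End R (RootSeries e) where
  toFun f := RootSeries.of e
    (MvPowerSeries.X 1 * MvPowerSeries.rescale ![ζ, 1] ((RootSeries.of e).symm f))
  map_add' f g := by
    rw [map_add, map_add, mul_add, map_add]
  map_smul' r f := by
    obtain ⟨g, rfl⟩ := (RootSeries.of e).surjective f
    rw [RootSeries.smul_of, RingEquiv.symm_apply_apply, RingEquiv.symm_apply_apply,
      RingHom.id_apply, RootSeries.smul_of, map_mul (MvPowerSeries.rescale _),
      MvPowerSeries.rescale_expand, mul_left_comm]
    intro s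
    fin_cases s
    · exact hζ
    · exact one_pow e

theorem xOp_of (g : MvPowerSeries (Fin 2) ℂ) :
    xOp e (RootSeries.of e g) = RootSeries.of e (MvPowerSeries.X 0 * g) := rfl

theorem yOp_of (hζ : ζ ^ e = 1) (g : MvPowerSeries (Fin 2) ℂ) :
    yOp hζ (RootSeries.of e g) =
      RootSeries.of e (MvPowerSeries.X 1 * MvPowerSeries.rescale ![ζ, 1] g) := rfl

theorem xOp_pow_of (n : ℕ) (g : MvPowerSeries (Fin 2) ℂ) :
    (xOp e ^ n) (RootSeries.of e g) = RootSeries.of e (MvPowerSeries.X 0 ^ n * g) := by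
  induction n generalizing g with
  | zero => rw [pow_zero, pow_zero, one_mul, Module.End.one_apply]
  | succ n ih =>
    rw [pow_succ, Module.End.mul_apply, xOp_of, ih, pow_succ, mul_assoc]

theorem yOp_pow_of (hζ : ζ ^ e = 1) (n : ℕ) (g : MvPowerSeries (Fin 2) ℂ) :
    (yOp hζ ^ n) (RootSeries.of e g) =
      RootSeries.of e (MvPowerSeries.X 1 ^ n * MvPowerSeries.rescale ![ζ ^ n, 1] g) := by
  induction n generalizing g with
  | zero =>
    have h1 : (![1, 1] : Fin 2 → ℂ) = 1 := by
      ext i; fin_cases i <;> rfl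
    rw [pow_zero, pow_zero, pow_zero, one_mul, h1, MvPowerSeries.rescale_one, RingHom.id_apply,
      Module.End.one_apply]
  | succ n ih =>
    have h1 : (![ζ, 1] * ![ζ ^ n, 1] : Fin 2 → ℂ) = ![ζ ^ (n + 1), 1] := by
      ext i; fin_cases i
      · exact (pow_succ' ζ n).symm
      · exact one_mul 1
    rw [pow_succ, Module.End.mul_apply, yOp_of, ih, map_mul (MvPowerSeries.rescale _),
      MvPowerSeries.rescale_X,
      MvPowerSeries.rescale_rescale, h1]
    simp only [Matrix.cons_val_one, map_one, one_mul, Matrix.cons_val_fin_one]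
    rw [pow_succ (MvPowerSeries.X 1 : MvPowerSeries (Fin 2) ℂ) n, mul_assoc]

/-- The action of `S` on `ℂ[[x,y]]`. -/
def rootSeriesAction (hζ : ζ ^ e = 1) : Salg e ζ →ₐ[R] Module.End R (RootSeries e) :=
  RingQuot.liftAlgHom R ⟨FreeAlgebra.lift R ![xOp e, yOp hζ], by
    intro a b h
    cases h with
    | xe =>
      rw [map_pow, FreeAlgebra.lift_ι_apply, AlgHom.commutes]
      refine LinearMap.ext fun f => ?_
      obtain ⟨g, rfl⟩ := (RootSeries.of e).surjective f
      refine (xOp_pow_of e g).trans ?_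
      rw [Module.algebraMap_end_apply, RootSeries.smul_of, MvPowerSeries.expand_X]
    | ye =>
      rw [map_pow, FreeAlgebra.lift_ι_apply, AlgHom.commutes]
      refine LinearMap.ext fun f => ?_
      obtain ⟨g, rfl⟩ := (RootSeries.of e).surjective f
      refine (yOp_pow_of hζ e g).trans ?_
      have h1 : (![ζ ^ e, 1] : Fin 2 → ℂ) = 1 := by
        rw [hζ]; ext i; fin_cases i <;> rfl
      rw [Module.algebraMap_end_apply, RootSeries.smul_of, MvPowerSeries.expand_X, h1,
        MvPowerSeries.rescale_one, RingHom.id_apply]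
    | comm =>
      rw [map_mul, map_mul, map_mul, FreeAlgebra.lift_ι_apply, FreeAlgebra.lift_ι_apply,
        AlgHom.commutes]
      refine LinearMap.ext fun f => ?_
      obtain ⟨g, rfl⟩ := (RootSeries.of e).surjective f
      have hC : algebraMap ℂ R ζ = MvPowerSeries.C ζ := rfl
      rw [Module.End.mul_apply, Module.End.mul_apply, Module.End.mul_apply,
        Module.algebraMap_end_apply]
      change yOp hζ (xOp e _) = _ • xOp e (yOp hζ _)
      rw [xOp_of, yOp_of, yOp_of, xOp_of, RootSeries.smul_of, hC, MvPowerSeries.expand_C,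
        map_mul (MvPowerSeries.rescale _),
        MvPowerSeries.rescale_X]
      simp only [Matrix.cons_val_zero]
      congr 1
      ring⟩

theorem rootSeriesAction_xS (hζ : ζ ^ e = 1) : rootSeriesAction hζ (xS e ζ) = xOp e := by
  rw [rootSeriesAction, xS, RingQuot.liftAlgHom_mkAlgHom_apply, FreeAlgebra.lift_ι_apply]
  rfl

theorem rootSeriesAction_yS (hζ : ζ ^ e = 1) : rootSeriesAction hζ (yS e ζ) = yOp hζ := by
  rw [rootSeriesAction, yS, RingQuot.liftAlgHom_mkAlgHom_apply, FreeAlgebra.lift_ι_apply]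
  rfl

/-- The monomials `x ^ i * y ^ j` with `i, j < e`. -/
def monomialS (e : ℕ) (ζ : ℂ) (p : Fin e × Fin e) : Salg e ζ :=
  xS e ζ ^ (p.1 : ℕ) * yS e ζ ^ (p.2 : ℕ)

theorem lexOrder_xOp_pow_yOp_pow (hζ : ζ ^ e = 1) (r : R) (i j : ℕ) (g : MvPowerSeries (Fin 2) ℂ) :
    MvPowerSeries.lexOrder
        ((RootSeries.of e).symm (r • (xOp e ^ i * yOp hζ ^ j) (RootSeries.of e g))) =
      MvPowerSeries.lexOrder (MvPowerSeries.expand e (NeZero.ne e) r) +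
        (i • ((toLex (Finsupp.single (0 : Fin 2) 1) : Lex (Fin 2 →₀ ℕ)) :
            WithTop (Lex (Fin 2 →₀ ℕ))) +
          (j • ((toLex (Finsupp.single (1 : Fin 2) 1) : Lex (Fin 2 →₀ ℕ)) :
            WithTop (Lex (Fin 2 →₀ ℕ))) +
          MvPowerSeries.lexOrder g)) := by
  have hζ0 : ζ ≠ 0 := by
    rintro rfl
    rw [zero_pow (NeZero.ne e)] at hζ
    exact zero_ne_one hζ
  have hpow : ∀ (s : Fin 2) (n : ℕ) (g : MvPowerSeries (Fin 2) ℂ),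
      MvPowerSeries.lexOrder (MvPowerSeries.X s ^ n * g) =
        n • ((toLex (Finsupp.single s 1) : Lex (Fin 2 →₀ ℕ)) : WithTop (Lex (Fin 2 →₀ ℕ))) +
          MvPowerSeries.lexOrder g := by
    intro s n g
    induction n with
    | zero => rw [pow_zero, one_mul, zero_nsmul, zero_add]
    | succ n ih =>
      rw [pow_succ', mul_assoc, MvPowerSeries.lexOrder_mul, ih, MvPowerSeries.lexOrder_X,
        succ_nsmul', add_assoc]
  rw [Module.End.mul_apply, yOp_pow_of, xOp_pow_of, RootSeries.smul_of,
    RingEquiv.symm_apply_apply, MvPowerSeries.lexOrder_mul, hpow, hpow, MvPowerSeries.lexOrder_rescale]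
  intro s
  fin_cases s
  · exact (pow_ne_zero j hζ0).isUnit
  · exact isUnit_one

theorem rootSeriesAction_sum_ne_zero (hζ : ζ ^ e = 1) {c : Fin e × Fin e → R}
    (hc : c ≠ 0) {f : RootSeries e} (hf : f ≠ 0) :
    rootSeriesAction hζ (∑ p, c p • monomialS e ζ p) f ≠ 0 := by
  have hterm : ∀ p, rootSeriesAction hζ (c p • monomialS e ζ p) f =
      c p • (xOp e ^ (p.1 : ℕ) * yOp hζ ^ (p.2 : ℕ)) f := by
    intro p
    rw [map_smul, monomialS, map_mul, map_pow, map_pow, rootSeriesAction_xS,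
      rootSeriesAction_yS]
    rfl
  rw [map_sum, LinearMap.sum_apply]
  simp only [hterm]
  obtain ⟨φ, rfl⟩ := (RootSeries.of e).surjective f
  obtain ⟨g, hg⟩ := MvPowerSeries.exists_finsupp_eq_lexOrder_of_ne_zero
    ((map_ne_zero_iff _ (RootSeries.of e).injective).1 hf)
  have hord : ∀ p, c p ≠ 0 → ∃ d : Fin 2 →₀ ℕ, (∀ i, e ∣ d i) ∧
      MvPowerSeries.lexOrder ((RootSeries.of e).symm
        (c p • (xOp e ^ (p.1 : ℕ) * yOp hζ ^ (p.2 : ℕ)) (RootSeries.of e φ))) =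
      ((toLex (d + (Finsupp.single 0 (p.1 : ℕ) + (Finsupp.single 1 (p.2 : ℕ) + g))) :
        Lex (Fin 2 →₀ ℕ)) : WithTop (Lex (Fin 2 →₀ ℕ))) := by
    intro p hp
    obtain ⟨d, hd, hd'⟩ := MvPowerSeries.exists_lexOrder_expand e (NeZero.ne e) hp
    refine ⟨d, hd, ?_⟩
    have hs : ∀ (i : Fin 2) (n : ℕ), n • (toLex (Finsupp.single i 1) : Lex (Fin 2 →₀ ℕ)) =
        toLex (Finsupp.single i n) := fun i n =>
      congrArg toLex ((Finsupp.smul_single n i 1).trans (by rw [smul_eq_mul, mul_one]))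
    rw [lexOrder_xOp_pow_yOp_pow, hd', hg, ← WithTop.coe_nsmul, ← WithTop.coe_nsmul, hs, hs]
    rfl
  refine (map_ne_zero_iff _ (RootSeries.of e).symm.injective).1 ?_
  rw [map_sum]
  refine MvPowerSeries.sum_ne_zero_of_lexOrder_injOn (σ := Fin 2) (A := ℂ) ?_ ?_
  · obtain ⟨p, hp⟩ := Function.ne_iff.1 hc
    refine ⟨p, Finset.mem_univ p, fun h0 => ?_⟩
    obtain ⟨d, -, hd⟩ := hord p hp
    rw [h0, MvPowerSeries.lexOrder_zero] at hd
    exact WithTop.top_ne_coe hd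
  · intro p _ q _ hp hq hpq
    have hcoef : ∀ p, (RootSeries.of e).symm
        (c p • (xOp e ^ (p.1 : ℕ) * yOp hζ ^ (p.2 : ℕ)) (RootSeries.of e φ)) ≠ 0 →
        c p ≠ 0 := by
      intro p hp h
      exact hp (by rw [h, zero_smul, map_zero])
    obtain ⟨d, hd, hd'⟩ := hord p (hcoef p hp)
    obtain ⟨d', hd₁, hd₁'⟩ := hord q (hcoef q hq)
    rw [hd', hd₁', WithTop.coe_inj, toLex_inj] at hpq
    have aux : ∀ {a b m n k : ℕ}, e ∣ a → e ∣ b → m < e → n < e → a + (m + k) = b + (n + k) →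
        m = n := by
      rintro _ _ m n k ⟨a, rfl⟩ ⟨b, rfl⟩ hm hn h
      have h' : e * a + m = e * b + n := by omega
      have := congrArg (· % e) h'
      simpa [Nat.mod_eq_of_lt hm, Nat.mod_eq_of_lt hn] using this
    have h0 := DFunLike.congr_fun hpq 0
    have h1 := DFunLike.congr_fun hpq 1
    simp only [Finsupp.add_apply, Finsupp.single_apply, Fin.isValue, ↓reduceIte, one_ne_zero,
      zero_ne_one, zero_add] at h0 h1
    exact Prod.ext (Fin.ext (aux (hd 0) (hd₁ 0) p.1.2 q.1.2 h0))
      (Fin.ext (aux (hd 1) (hd₁ 1) p.2.2 q.2.2 h1))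

end Representation

section Basis

variable {e : ℕ} {ζ : ℂ}

local instance : Ring (Salg e ζ) := Algebra.semiringToRing R

theorem xS_pow_self : xS e ζ ^ e = algebraMap R (Salg e ζ) u := by
  rw [xS, ← map_pow, RingQuot.mkAlgHom_rel R Srel.xe, AlgHom.commutes]

theorem yS_pow_self : yS e ζ ^ e = algebraMap R (Salg e ζ) v := by
  rw [yS, ← map_pow, RingQuot.mkAlgHom_rel R Srel.ye, AlgHom.commutes]

theorem yS_mul_xS : yS e ζ * xS e ζ = algebraMap ℂ R ζ • (xS e ζ * yS e ζ) := by
  rw [xS, yS, ← map_mul, RingQuot.mkAlgHom_rel R Srel.comm, map_mul, AlgHom.commutes, map_mul,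
    Algebra.smul_def]

theorem yS_mul_xS_pow (n : ℕ) :
    yS e ζ * xS e ζ ^ n = algebraMap ℂ R ζ ^ n • (xS e ζ ^ n * yS e ζ) := by
  induction n with
  | zero => simp
  | succ n ih =>
    rw [pow_succ, ← mul_assoc, ih, smul_mul_assoc, mul_assoc, yS_mul_xS, mul_smul_comm, smul_smul,
      ← pow_succ, mul_assoc]

theorem yS_pow_mul_xS_pow (m n : ℕ) :
    yS e ζ ^ m * xS e ζ ^ n = algebraMap ℂ R ζ ^ (n * m) • (xS e ζ ^ n * yS e ζ ^ m) := by
  induction m with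
  | zero => simp
  | succ m ih =>
    rw [pow_succ', mul_assoc, ih, mul_smul_comm, ← mul_assoc, yS_mul_xS_pow, smul_mul_assoc,
      smul_smul, ← pow_add, mul_assoc, Nat.mul_succ]

theorem xS_pow_mul_yS_pow_mem_span [NeZero e] (i j : ℕ) :
    xS e ζ ^ i * yS e ζ ^ j ∈ Submodule.span R (Set.range (monomialS e ζ)) := by
  have he : 0 < e := Nat.pos_of_ne_zero (NeZero.ne e)
  rw [← Nat.div_add_mod i e, ← Nat.div_add_mod j e, pow_add, pow_add, pow_mul, pow_mul,
    xS_pow_self, yS_pow_self, ← map_pow, ← map_pow, mul_assoc, ← Algebra.smul_def,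
    Algebra.left_comm, ← Algebra.smul_def]
  exact Submodule.smul_mem _ _ (Submodule.smul_mem _ _
    (Submodule.subset_span ⟨(⟨i % e, Nat.mod_lt _ he⟩, ⟨j % e, Nat.mod_lt _ he⟩), rfl⟩))

theorem mul_mem_span_monomialS [NeZero e] {a b : Salg e ζ}
    (ha : a ∈ Submodule.span R (Set.range (monomialS e ζ)))
    (hb : b ∈ Submodule.span R (Set.range (monomialS e ζ))) :
    a * b ∈ Submodule.span R (Set.range (monomialS e ζ)) := by
  induction ha, hb using Submodule.span_induction₂ with
  | mem_mem a b ha hb =>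
    obtain ⟨p, rfl⟩ := ha
    obtain ⟨q, rfl⟩ := hb
    have h : monomialS e ζ p * monomialS e ζ q = algebraMap ℂ R ζ ^ ((q.1 : ℕ) * (p.2 : ℕ)) •
        (xS e ζ ^ ((p.1 : ℕ) + q.1) * yS e ζ ^ ((p.2 : ℕ) + q.2)) := by
      rw [monomialS, monomialS, mul_assoc, ← mul_assoc (yS e ζ ^ _), yS_pow_mul_xS_pow,
        smul_mul_assoc, mul_smul_comm, pow_add, pow_add]
      simp only [mul_assoc]
    rw [h]
    exact Submodule.smul_mem _ _ (xS_pow_mul_yS_pow_mem_span _ _)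
  | zero_left b hb => rw [zero_mul]; exact zero_mem _
  | zero_right a ha => rw [mul_zero]; exact zero_mem _
  | add_left a b c _ _ _ h₁ h₂ => rw [add_mul]; exact add_mem h₁ h₂
  | add_right a b c _ _ _ h₁ h₂ => rw [mul_add]; exact add_mem h₁ h₂
  | smul_left r a b _ _ h => rw [smul_mul_assoc]; exact Submodule.smul_mem _ _ h
  | smul_right r a b _ _ h => rw [mul_smul_comm]; exact Submodule.smul_mem _ _ h

theorem span_monomialS [NeZero e] : Submodule.span R (Set.range (monomialS e ζ)) = ⊤ := by
  refine Submodule.eq_top_iff'.2 fun s => ?_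
  obtain ⟨s, rfl⟩ := RingQuot.mkAlgHom_surjective R (Srel e ζ) s
  induction s using FreeAlgebra.induction with
  | grade0 r =>
    rw [AlgHom.commutes, Algebra.algebraMap_eq_smul_one]
    refine Submodule.smul_mem _ _ ?_
    simpa using xS_pow_mul_yS_pow_mem_span (e := e) (ζ := ζ) 0 0
  | grade1 i =>
    fin_cases i
    · simpa [xS] using xS_pow_mul_yS_pow_mem_span (e := e) (ζ := ζ) 1 0
    · simpa [yS] using xS_pow_mul_yS_pow_mem_span (e := e) (ζ := ζ) 0 1
  | mul a b ha hb => rw [map_mul]; exact mul_mem_span_monomialS ha hb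
  | add a b ha hb => rw [map_add]; exact add_mem ha hb

theorem linearIndependent_monomialS [NeZero e] (hζ : ζ ^ e = 1) :
    LinearIndependent R (monomialS e ζ) := by
  refine Fintype.linearIndependent_iff.2 fun c hc => ?_
  by_contra! h
  refine rootSeriesAction_sum_ne_zero hζ (c := c) (Function.ne_iff.2 h)
    (f := RootSeries.of e 1)
    ((map_ne_zero_iff _ (RootSeries.of e).injective).2 one_ne_zero) ?_
  rw [hc, map_zero, LinearMap.zero_apply]

/-- The `R`-basis of `S` formed by the monomials `x ^ i * y ^ j` with `i, j < e`. -/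
def basisS [NeZero e] (hζ : ζ ^ e = 1) : Module.Basis (Fin e × Fin e) R (Salg e ζ) :=
  Module.Basis.mk (linearIndependent_monomialS hζ) span_monomialS.ge

theorem rootSeriesAction_apply_ne_zero [NeZero e] (hζ : ζ ^ e = 1) {s : Salg e ζ} (hs : s ≠ 0)
    {f : RootSeries e} (hf : f ≠ 0) : rootSeriesAction hζ s f ≠ 0 := by
  have hsum := (basisS hζ).sum_repr s
  simp only [basisS, Module.Basis.mk_apply] at hsum
  rw [← hsum]
  refine rootSeriesAction_sum_ne_zero hζ (fun h => hs ?_) hf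
  rw [← hsum]
  refine Finset.sum_eq_zero fun p _ => ?_
  rw [show _ = (0 : R) from congrFun h p, zero_smul]

theorem Salg_isDomain [NeZero e] (hζ : ζ ^ e = 1) : IsDomain (Salg e ζ) := by
  have : Nontrivial (Salg e ζ) := (basisS hζ).repr.toEquiv.nontrivial
  have : NoZeroDivisors (Salg e ζ) := by
    refine ⟨fun {s t} h => ?_⟩
    by_contra! hst
    have h1 : RootSeries.of e 1 ≠ 0 :=
      (map_ne_zero_iff _ (RootSeries.of e).injective).2 one_ne_zero
    refine rootSeriesAction_apply_ne_zero hζ hst.1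
      (rootSeriesAction_apply_ne_zero hζ hst.2 h1) ?_
    rw [← Module.End.mul_apply, ← map_mul, h, map_zero, LinearMap.zero_apply]
  exact NoZeroDivisors.to_isDomain _

theorem xS_ne_zero [NeZero e] (hζ : ζ ^ e = 1) : xS e ζ ≠ 0 := by
  intro h
  have h1 := congrArg (fun s => rootSeriesAction hζ s (RootSeries.of e 1)) h
  simp only [rootSeriesAction_xS, map_zero] at h1
  rw [xOp_of, mul_one, LinearMap.zero_apply] at h1
  exact MvPowerSeries.X_ne_zero 0 ((map_eq_zero_iff _ (RootSeries.of e).injective).1 h1)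

theorem yS_ne_zero [NeZero e] (hζ : ζ ^ e = 1) : yS e ζ ≠ 0 := by
  intro h
  have h1 := congrArg (fun s => rootSeriesAction hζ s (RootSeries.of e 1)) h
  simp only [rootSeriesAction_yS, map_zero] at h1
  rw [yOp_of, map_one, mul_one, LinearMap.zero_apply] at h1
  exact MvPowerSeries.X_ne_zero 1 ((map_eq_zero_iff _ (RootSeries.of e).injective).1 h1)

theorem mem_range_algebraMap_of_commute [NeZero e] (hζ : IsPrimitiveRoot ζ e) {s : Salg e ζ}
    (hx : Commute (xS e ζ) s) (hy : Commute (yS e ζ) s) :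
    s ∈ Set.range (algebraMap R (Salg e ζ)) := by
  have := Salg_isDomain hζ.pow_eq_one
  set b := basisS hζ.pow_eq_one with hb
  obtain ⟨c, hsum⟩ : ∃ c : Fin e × Fin e → R, ∑ p, c p • b p = s := ⟨_, b.sum_repr s⟩
  have hζ' : ∀ n : ℕ, n < e → 1 - algebraMap ℂ R ζ ^ n = 0 → n = 0 := by
    intro n hn h
    rw [sub_eq_zero, ← map_pow, ← map_one (algebraMap ℂ R)] at h
    have := (algebraMap ℂ R).injective h
    exact Nat.eq_zero_of_dvd_of_lt (hζ.dvd_of_pow_eq_one n this.symm) hn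
  have hbp : ∀ p, b p = xS e ζ ^ (p.1 : ℕ) * yS e ζ ^ (p.2 : ℕ) := fun p => by
    rw [hb, basisS, Module.Basis.mk_apply, monomialS]
  have hindep := Fintype.linearIndependent_iff.1 b.linearIndependent
  have h2 : ∀ p, c p * (1 - algebraMap ℂ R ζ ^ (p.2 : ℕ)) = 0 := by
    refine hindep _ ?_
    refine (eq_zero_or_eq_zero_of_mul_eq_zero (a := xS e ζ) ?_).resolve_left ?_
    · rw [← sub_eq_zero.2 hx.eq, ← hsum, Finset.mul_sum, Finset.mul_sum, Finset.sum_mul,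
        ← Finset.sum_sub_distrib]
      refine Finset.sum_congr rfl fun p _ => ?_
      have := yS_pow_mul_xS_pow (e := e) (ζ := ζ) (p.2 : ℕ) 1
      rw [pow_one, one_mul] at this
      rw [hbp, mul_smul_comm, mul_smul_comm, smul_mul_assoc, mul_assoc (xS e ζ ^ (p.1 : ℕ)), this,
        mul_smul_comm, smul_smul, ← mul_assoc, ← mul_assoc, ← pow_succ', ← pow_succ, mul_sub,
        mul_one, sub_smul]
    · exact xS_ne_zero hζ.pow_eq_one
  have h1 : ∀ p, c p * (1 - algebraMap ℂ R ζ ^ (p.1 : ℕ)) = 0 := by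
    refine hindep _ ?_
    refine (eq_zero_or_eq_zero_of_mul_eq_zero (b := yS e ζ) ?_).resolve_right
      (yS_ne_zero hζ.pow_eq_one)
    rw [← sub_eq_zero.2 hy.eq.symm, ← hsum, Finset.mul_sum, Finset.sum_mul, Finset.sum_mul,
      ← Finset.sum_sub_distrib]
    refine Finset.sum_congr rfl fun p _ => ?_
    rw [hbp, mul_smul_comm, smul_mul_assoc, smul_mul_assoc, ← mul_assoc (yS e ζ),
      yS_mul_xS_pow, smul_mul_assoc, smul_smul, mul_assoc, mul_assoc, ← pow_succ', ← pow_succ,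
      mul_sub, mul_one, sub_smul]
  have h0 : ∀ p, p ≠ (0 : Fin e × Fin e) → c p = 0 := by
    intro p hp
    by_contra hne
    refine hp (Prod.ext (Fin.ext ?_) (Fin.ext ?_))
    · exact hζ' _ p.1.2 ((mul_eq_zero.1 (h1 p)).resolve_left hne)
    · exact hζ' _ p.2.2 ((mul_eq_zero.1 (h2 p)).resolve_left hne)
  refine ⟨c 0, ?_⟩
  rw [← hsum, Finset.sum_eq_single_of_mem 0 (Finset.mem_univ _)
    fun p _ hp => by rw [h0 p hp, zero_smul], hbp, Algebra.algebraMap_eq_smul_one]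
  simp

end Basis

section BaseChange

open TensorProduct

variable {A F B : Type*} [CommRing A] [IsDomain A] [Field F] [Algebra A F] [IsFractionRing A F]
  [Ring B] [Algebra A B]

theorem exists_smul_eq_one_tmul (t : F ⊗[A] B) :
    ∃ (r : A) (b : B), r ≠ 0 ∧ algebraMap A F r • t = 1 ⊗ₜ[A] b := by
  obtain ⟨⟨b, r⟩, h⟩ := IsLocalizedModule.surj (nonZeroDivisors A) (TensorProduct.mk A F B 1) t
  refine ⟨r, b, nonZeroDivisors.coe_ne_zero r, ?_⟩
  rw [algebraMap_smul]
  exact h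

theorem isDomain_fractionField_tensorProduct [Module.Flat A B] [IsDomain B] :
    IsDomain (F ⊗[A] B) := by
  have hinj : Function.Injective (Algebra.TensorProduct.includeRight : B →ₐ[A] F ⊗[A] B) :=
    Algebra.TensorProduct.includeRight_injective (IsFractionRing.injective A F)
  have : Nontrivial (F ⊗[A] B) := hinj.nontrivial
  have : NoZeroDivisors (F ⊗[A] B) := by
    refine ⟨fun {s t} h => ?_⟩
    obtain ⟨r, b, hr, hb⟩ := exists_smul_eq_one_tmul s
    obtain ⟨r', b', hr', hb'⟩ := exists_smul_eq_one_tmul t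
    have hF : ∀ {a : A}, a ≠ 0 → algebraMap A F a ≠ 0 := fun ha =>
      (map_ne_zero_iff _ (IsFractionRing.injective A F)).2 ha
    have hmul : b * b' = 0 := by
      apply hinj
      rw [map_mul, map_zero, Algebra.TensorProduct.includeRight_apply,
        Algebra.TensorProduct.includeRight_apply, ← hb, ← hb', smul_mul_smul_comm, h, smul_zero]
    refine (mul_eq_zero.1 hmul).imp (fun h0 => ?_) fun h0 => ?_
    · rw [h0, tmul_zero] at hb
      exact (smul_eq_zero.1 hb).resolve_left (hF hr)
    · rw [h0, tmul_zero] at hb'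
      exact (smul_eq_zero.1 hb').resolve_left (hF hr')
  exact NoZeroDivisors.to_isDomain _

theorem mem_range_algebraMap_of_mem_center_tensorProduct [Module.Flat A B]
    (hB : Set.center B ⊆ Set.range (algebraMap A B)) {t : F ⊗[A] B}
    (ht : t ∈ Set.center (F ⊗[A] B)) : t ∈ Set.range (algebraMap F (F ⊗[A] B)) := by
  have hinj : Function.Injective (Algebra.TensorProduct.includeRight : B →ₐ[A] F ⊗[A] B) :=
    Algebra.TensorProduct.includeRight_injective (IsFractionRing.injective A F)
  obtain ⟨r, b, hr, hb⟩ := exists_smul_eq_one_tmul t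
  have hb' : b ∈ Set.center B := by
    refine Semigroup.mem_center_iff.2 fun c => hinj ?_
    rw [map_mul, map_mul]
    simp only [Algebra.TensorProduct.includeRight_apply]
    rw [← hb, smul_mul_assoc, mul_smul_comm, Semigroup.mem_center_iff.1 ht]
  obtain ⟨a, rfl⟩ := hB hb'
  have hr' : algebraMap A F r ≠ 0 := (map_ne_zero_iff _ (IsFractionRing.injective A F)).2 hr
  refine ⟨(algebraMap A F r)⁻¹ * algebraMap A F a, ?_⟩
  have h1 : (1 : F) ⊗ₜ[A] algebraMap A B a = algebraMap F (F ⊗[A] B) (algebraMap A F a) := by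
    rw [Algebra.TensorProduct.algebraMap_apply, Algebra.algebraMap_self, RingHom.id_apply,
      Algebra.algebraMap_eq_smul_one, Algebra.algebraMap_eq_smul_one, tmul_smul, smul_tmul']
  rw [map_mul, ← h1, ← hb, ← Algebra.smul_def, smul_smul, inv_mul_cancel₀ hr', one_smul]

/-- A free algebra without zero divisors over a domain `A` whose center is `A` becomes a central
division algebra over the field of fractions of `A`. -/
theorem isCentralDivision_fractionField_tensorProduct {C ι : Type*} [Semiring C] [Algebra A C]
    [IsDomain C] [Fintype ι] (b : Module.Basis ι A C)
    (hC : Set.center C ⊆ Set.range (algebraMap A C)) :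
    Nontrivial (F ⊗[A] C) ∧
    (∀ a : F ⊗[A] C, a ≠ 0 → IsUnit a) ∧
    Module.finrank F (F ⊗[A] C) = Fintype.card ι ∧
    (∀ t : F ⊗[A] C, t ∈ Set.center (F ⊗[A] C) ↔ t ∈ Set.range (algebraMap F (F ⊗[A] C))) := by
  let : Ring C := Algebra.semiringToRing A
  let bF := Algebra.TensorProduct.basis F b
  have : Module.Free A C := Module.Free.of_basis b
  have : IsDomain (F ⊗[A] C) := isDomain_fractionField_tensorProduct
  have : FiniteDimensional F (F ⊗[A] C) := bF.finiteDimensional_of_finite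
  refine ⟨inferInstance, fun a ha => FiniteDimensional.isUnit F ha,
    Module.finrank_eq_card_basis bF, fun t => ⟨fun ht => ?_, ?_⟩⟩
  · exact mem_range_algebraMap_of_mem_center_tensorProduct hC ht
  · rintro ⟨c, rfl⟩
    exact Semigroup.mem_center_iff.2 fun g => (Algebra.commutes c g).symm

end BaseChange

/-!
STATEMENT 13: The `K`-algebra `S ⊗_R K` is a division ring; together with the fact that
`S` is free of rank `e²` over `R`, it is a central division algebra over `K` of dimension
`e²`.  (We realize `S ⊗_R K` as `K ⊗[R] S`, which carries the `K`-algebra structure.)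
-/

theorem Salg_tensor_fractionField_isDivisionRing (e : ℕ) (he : 1 ≤ e) (ζ : ℂ)
    (hζ : IsPrimitiveRoot ζ e) :
    Nontrivial (K ⊗[R] Salg e ζ) ∧
    (∀ a : K ⊗[R] Salg e ζ, a ≠ 0 → IsUnit a) ∧
    Module.finrank K (K ⊗[R] Salg e ζ) = e ^ 2 ∧
    (∀ t : K ⊗[R] Salg e ζ, t ∈ Set.center (K ⊗[R] Salg e ζ) ↔
      t ∈ Set.range (algebraMap K (K ⊗[R] Salg e ζ))) := by
  have : NeZero e := ⟨Nat.one_le_iff_ne_zero.1 he⟩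
  have : IsDomain (Salg e ζ) := Salg_isDomain hζ.pow_eq_one
  have h := isCentralDivision_fractionField_tensorProduct (F := K) (basisS hζ.pow_eq_one)
    fun s hs => mem_range_algebraMap_of_commute hζ (Semigroup.mem_center_iff.1 hs _)
      (Semigroup.mem_center_iff.1 hs _)
  rwa [Fintype.card_prod, Fintype.card_fin, ← sq] at h

end
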